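/- cof(HDZ) ≤ cof(N¹), where N¹ = {A ⊆ 2^ω : ℋ¹(A) = 0} is the ideal of subsets of the Cantor space of 1-dimensional Hausdorff measure zero (which coincides with the Lebesgue-null ideal on 2^ω), and HDZ = {A ⊆ 2^ω : dim_H(A) = 0}. -/

import Mathlib

open MeasureTheory Set
open scoped ENNReal

/-- The Cantor space `2^ω = ℕ → Bool` carries the metric
`d(x,y) = 2^{-min{n : x n ≠ y n}}` (and `d(x,x) = 0`). -/
noncomputable local instance cantorMetric : MetricSpace (ℕ → Bool) := PiNat.metricSpace

local instance cantorMeasurable : MeasurableSpace (ℕ → Bool) := borel _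

local instance cantorBorel : BorelSpace (ℕ → Bool) := ⟨rfl⟩

/-- The cofinality of a family `I` of subsets of `X`: the least cardinality of a
subfamily of `I` that is cofinal in `I` with respect to inclusion. -/
noncomputable def idealCof {X : Type*} (I : Set (Set X)) : Cardinal :=
  sInf {c : Cardinal | ∃ F : Set (Set X), F ⊆ I ∧
    (∀ A ∈ I, ∃ B ∈ F, A ⊆ B) ∧ c = Cardinal.mk F}
open Filter Topology ProbabilityTheory

lemma edist_le_iff_mem_cylinder {x y : ℕ → Bool} {n : ℕ} :
    edist y x ≤ (2⁻¹ : ℝ≥0∞) ^ n ↔ y ∈ PiNat.cylinder x n := by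
  have h : (2⁻¹ : ℝ≥0∞) ^ n = ENNReal.ofReal ((1 / 2) ^ n) := by
    rw [ENNReal.ofReal_pow (by norm_num), one_div, ENNReal.ofReal_inv_of_pos two_pos]
    simp
  rw [h, edist_dist, ENNReal.ofReal_le_ofReal_iff (by positivity)]
  exact PiNat.mem_cylinder_iff_dist_le.symm

lemma mem_cylinder_succ_of_edist_lt {x y : ℕ → Bool} {n : ℕ}
    (h : edist y x < (2⁻¹ : ℝ≥0∞) ^ n) : y ∈ PiNat.cylinder x (n + 1) := by
  have e : (2⁻¹ : ℝ≥0∞) ^ n = ENNReal.ofReal ((1 / 2) ^ n) := by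
    rw [ENNReal.ofReal_pow (by norm_num), one_div, ENNReal.ofReal_inv_of_pos two_pos]
    simp
  rw [e, edist_dist, ENNReal.ofReal_lt_ofReal_iff (by positivity)] at h
  exact fun i hi => PiNat.apply_eq_of_dist_lt h (Nat.lt_succ_iff.1 hi)

lemma ediam_cylinder_le (x : ℕ → Bool) (n : ℕ) :
    Metric.ediam (PiNat.cylinder x n) ≤ (2⁻¹ : ℝ≥0∞) ^ n := by
  refine Metric.ediam_le fun y hy z hz => edist_le_iff_mem_cylinder.2 ?_
  exact fun i hi => (hy i hi).trans (hz i hi).symm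

lemma subset_cylinder_of_ediam_le {s : Set (ℕ → Bool)} {x : ℕ → Bool} {n : ℕ} (hx : x ∈ s)
    (h : Metric.ediam s ≤ (2⁻¹ : ℝ≥0∞) ^ n) : s ⊆ PiNat.cylinder x n := fun _ hy =>
  edist_le_iff_mem_cylinder.1 ((Metric.edist_le_ediam_of_mem hy hx).trans h)

/-- The law of a sequence of independent fair coin flips. -/
lemma exists_fair_coin_measure {ι : Type*} (m : MeasurableSpace (ι → Bool))
    (hm : m = MeasurableSpace.pi) :
    ∃ μ : Measure (ι → Bool), IsProbabilityMeasure μ ∧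
      iIndepFun (fun (n : ι) (x : ι → Bool) => x n) μ ∧
      ∀ (n : ι) (b : Bool), μ {x | x n = b} = 2⁻¹ := by
  subst hm
  let P : ι → Measure Bool := fun _ => uniformOn univ
  have : ∀ n, IsProbabilityMeasure (P n) := fun n => by
    dsimp only [P]
    infer_instance
  refine ⟨Measure.infinitePi P, inferInstance,
    iIndepFun_infinitePi (X := fun _ b => b) fun _ => measurable_id, fun n b => ?_⟩
  have h := Measure.infinitePi_map_eval P n
  have h2 : (Measure.infinitePi P).map (fun x => x n) {b} = P n {b} := by rw [h]
  rw [Measure.map_apply (measurable_pi_apply n) (measurableSet_singleton b)] at h2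
  refine h2.trans ?_
  simp only [P]
  rw [uniformOn_univ]
  simp

lemma hausdorffMeasure_one_univ_le : μH[(1 : ℝ)] (univ : Set (ℕ → Bool)) ≤ 1 := by
  have key := Measure.hausdorffMeasure_le_liminf_sum (ι := fun n : ℕ => (Fin n → Bool)) (1 : ℝ)
    (univ : Set (ℕ → Bool)) (l := atTop) (fun n : ℕ => (2⁻¹ : ℝ≥0∞) ^ n)
    (ENNReal.tendsto_pow_atTop_nhds_zero_of_lt_one (by simp))
    (fun n f => PiNat.cylinder (fun k => if h : k < n then f ⟨k, h⟩ else false) n)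
    (Eventually.of_forall fun n f => ediam_cylinder_le _ _)
    (Eventually.of_forall fun n x _ => mem_iUnion.2 ⟨fun i => x i, fun i hi => by simp [hi]⟩)
  refine key.trans ?_
  have : ∀ n : ℕ, ∑ f : Fin n → Bool, Metric.ediam
      (PiNat.cylinder (fun k => if h : k < n then f ⟨k, h⟩ else false) n) ^ (1 : ℝ) ≤ 1 := by
    intro n
    calc _ ≤ ∑ f : Fin n → Bool, (2⁻¹ : ℝ≥0∞) ^ n := by
          refine Finset.sum_le_sum fun f _ => ?_
          rw [ENNReal.rpow_one]
          exact ediam_cylinder_le _ _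
      _ = 1 := by
          simp only [Finset.sum_const, Finset.card_univ, Fintype.card_fun, Fintype.card_bool,
            Fintype.card_fin, nsmul_eq_mul, Nat.cast_pow, Nat.cast_ofNat]
          rw [← mul_pow, ENNReal.mul_inv_cancel (by simp) (by simp), one_pow]
  exact liminf_le_of_le (by isBoundedDefault) fun b hb => by
    obtain ⟨n, hn⟩ := hb.exists
    exact hn.trans (this n)

lemma measure_le_ediam {μ : Measure (ℕ → Bool)} [IsProbabilityMeasure μ]
    (hμ : ∀ x n, μ (PiNat.cylinder x n) = (2⁻¹ : ℝ≥0∞) ^ n) (s : Set (ℕ → Bool)) :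
    μ s ≤ Metric.ediam s := by
  by_contra! h
  obtain ⟨x, hx⟩ : s.Nonempty := nonempty_of_measure_ne_zero (pos_of_gt h).ne'
  have key : ∀ n, μ s ≤ (2⁻¹ : ℝ≥0∞) ^ n := by
    intro n
    induction n with
    | zero => simpa using prob_le_one
    | succ n ih =>
      rw [← hμ x (n + 1)]
      exact measure_mono fun y hy => mem_cylinder_succ_of_edist_lt <|
        (Metric.edist_le_ediam_of_mem hy hx).trans_lt (h.trans_le ih)
  have : μ s ≤ 0 := ge_of_tendsto'
    (ENNReal.tendsto_pow_atTop_nhds_zero_of_lt_one (by simp)) key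
  exact not_lt_bot (h.trans_le this)

/-- On the Cantor space, `μH[1]` is the law of a sequence of independent fair coin flips. -/
lemma hausdorffMeasure_one_fair_coin :
    IsProbabilityMeasure (μH[(1 : ℝ)] : Measure (ℕ → Bool)) ∧
      iIndepFun (fun (n : ℕ) (x : ℕ → Bool) => x n) μH[(1 : ℝ)] ∧
      ∀ (n : ℕ) (b : Bool), μH[(1 : ℝ)] {x : ℕ → Bool | x n = b} = 2⁻¹ := by
  obtain ⟨μ, hμ, hind, hhalf⟩ := exists_fair_coin_measure cantorMeasurable
    (@BorelSpace.measurable_eq (ℕ → Bool) _ MeasurableSpace.pi _).symm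
  have hcyl : ∀ x n, μ (PiNat.cylinder x n) = (2⁻¹ : ℝ≥0∞) ^ n := by
    intro x n
    have h := hind.measure_inter_preimage_eq_mul (S := Finset.range n) (sets := fun i => {x i})
      (fun i _ => measurableSet_singleton _)
    have e : PiNat.cylinder x n = ⋂ i ∈ Finset.range n, (fun y : ℕ → Bool => y i) ⁻¹' {x i} := by
      ext y
      simp [PiNat.cylinder]
    rw [e, h]
    refine (Finset.prod_congr rfl fun i _ => hhalf i (x i)).trans ?_
    simp
  have hle : μ ≤ μH[(1 : ℝ)] := Measure.le_hausdorffMeasure 1 μ 1 one_pos fun s _ => by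
    rw [ENNReal.rpow_one]
    exact measure_le_ediam hcyl s
  have heq : μ = μH[(1 : ℝ)] := Measure.eq_of_le_of_measure_univ_eq hle
    (le_antisymm (hle univ) (by simpa using hausdorffMeasure_one_univ_le))
  rw [← heq]
  exact ⟨hμ, hind, hhalf⟩

lemma hausdorffMeasure_frequently_eq_zero {X : Type*} [EMetricSpace X] [MeasurableSpace X]
    [BorelSpace X] {s : ℝ} (hs : 0 < s) {t : ℕ → Set X}
    (ht : ∑' i, Metric.ediam (t i) ^ s ≠ ∞) : μH[s] {x | ∃ᶠ i in atTop, x ∈ t i} = 0 := by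
  have h0 := ENNReal.tendsto_sum_nat_add (fun i => Metric.ediam (t i) ^ s) ht
  have hr : Tendsto (fun n => (∑' i, Metric.ediam (t (i + n)) ^ s) ^ s⁻¹) atTop (𝓝 0) := by
    have := ((ENNReal.continuous_rpow_const (y := s⁻¹)).tendsto 0).comp h0
    rwa [ENNReal.zero_rpow_of_pos (inv_pos.2 hs)] at this
  have key := Measure.hausdorffMeasure_le_liminf_tsum (ι := fun _ : ℕ => ℕ) s
    {x | ∃ᶠ i in atTop, x ∈ t i} _ hr (fun n i => t (i + n))
    (Eventually.of_forall fun n i => by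
      rw [ENNReal.le_rpow_inv_iff hs]
      exact ENNReal.le_tsum (f := fun i => Metric.ediam (t (i + n)) ^ s) i)
    (Eventually.of_forall fun n x hx => by
      obtain ⟨i, hi, hxi⟩ := (frequently_atTop.1 hx) n
      exact mem_iUnion.2 ⟨i - n, by rwa [Nat.sub_add_cancel hi]⟩)
  rw [h0.liminf_eq] at key
  exact le_antisymm key zero_le

/-- The cylinder of all sequences agreeing with the indicator of `a` below `n`. -/
def finsetCylinder (n : ℕ) (a : Finset ℕ) : Set (ℕ → Bool) :=
  PiNat.cylinder (fun k => decide (k ∈ a)) n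

lemma exists_finsetCylinder_eq (x : ℕ → Bool) (n : ℕ) :
    ∃ a, finsetCylinder n a = PiNat.cylinder x n := by
  refine ⟨(Finset.range n).filter fun k => x k = true, ?_⟩
  ext y
  refine forall₂_congr fun i hi => ?_
  simp [hi]

lemma exists_subset_finsetCylinder {M : ℕ} {s : ℝ} (hs : 0 ≤ s) (hMs : M * s = 1)
    {t : Set (ℕ → Bool)} (ht : Metric.ediam t ≤ 1) {δ : ℝ≥0∞} (hδ : 0 < δ) :
    ∃ (l : ℕ) (a : Finset ℕ), t ⊆ finsetCylinder (M * l) a ∧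
      (2⁻¹ : ℝ≥0∞) ^ l ≤ 2 * (⨆ _ : t.Nonempty, Metric.ediam t ^ s) + δ := by
  obtain ⟨L, hL⟩ := ((ENNReal.tendsto_pow_atTop_nhds_zero_of_lt_one
    (r := (2⁻¹ : ℝ≥0∞)) (by simp)).eventually (gt_mem_nhds hδ)).exists
  rcases t.eq_empty_or_nonempty with rfl | hne
  · exact ⟨L, ∅, empty_subset _, le_add_left hL.le⟩
  obtain ⟨x, hx⟩ := hne
  have cover : ∀ l, Metric.ediam t ≤ (2⁻¹ : ℝ≥0∞) ^ (M * l) →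
      ∃ a, t ⊆ finsetCylinder (M * l) a := fun l hl => by
    obtain ⟨a, ha⟩ := exists_finsetCylinder_eq x (M * l)
    exact ⟨a, ha ▸ subset_cylinder_of_ediam_le hx hl⟩
  by_cases hall : Metric.ediam t ≤ (2⁻¹ : ℝ≥0∞) ^ (M * L)
  · obtain ⟨a, ha⟩ := cover L hall
    exact ⟨L, a, ha, le_add_left hL.le⟩
  have hex : ∃ l, ¬ Metric.ediam t ≤ (2⁻¹ : ℝ≥0∞) ^ (M * l) := ⟨L, hall⟩
  classical
  obtain ⟨l, hl⟩ : ∃ l, Nat.find hex = l + 1 := by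
    refine Nat.exists_eq_succ_of_ne_zero fun h => ?_
    have := Nat.find_spec hex
    rw [h] at this
    simp [ht] at this
  have hspec := Nat.find_spec hex
  rw [hl] at hspec
  obtain ⟨a, ha⟩ := cover l (not_not.1 (Nat.find_min hex (hl ▸ Nat.lt_succ_self l)))
  refine ⟨l, a, ha, le_add_right ?_⟩
  rw [ciSup_pos ⟨x, hx⟩]
  have h := ENNReal.rpow_le_rpow (not_le.1 hspec).le hs
  have e : ((2⁻¹ : ℝ≥0∞) ^ (M * (l + 1))) ^ s = 2⁻¹ ^ (l + 1) := by
    rw [← ENNReal.rpow_natCast, ← ENNReal.rpow_mul, ← ENNReal.rpow_natCast]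
    congr 1
    push_cast
    linear_combination ((l : ℝ) + 1) * hMs
  rw [e] at h
  calc (2⁻¹ : ℝ≥0∞) ^ l = 2 * 2⁻¹ ^ (l + 1) := by
        rw [pow_succ, mul_comm, mul_assoc, ENNReal.inv_mul_cancel (by simp) (by simp), mul_one]
    _ ≤ _ := by gcongr

lemma exists_finsetCylinder_cover {M : ℕ} {s : ℝ} (hs : 0 ≤ s) (hMs : M * s = 1)
    {A : Set (ℕ → Bool)} (hA : μH[s] A = 0) {ε : ℝ≥0∞} (hε : 0 < ε) :
    ∃ f : ℕ → ℕ × Finset ℕ, (A ⊆ ⋃ n, finsetCylinder (M * (f n).1) (f n).2) ∧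
      ∑' n, (2⁻¹ : ℝ≥0∞) ^ (f n).1 ≤ ε := by
  rw [Measure.hausdorffMeasure_apply] at hA
  simp only [ENNReal.iSup_eq_zero] at hA
  have h1 := hA 1 one_pos
  have hε' : (0 : ℝ≥0∞) < ε / 4 := ENNReal.div_pos hε.ne' (by simp)
  rw [← h1] at hε'
  simp only [iInf_lt_iff] at hε'
  obtain ⟨t, hAt, htd, hsum⟩ := hε'
  obtain ⟨δ, hδ, hδsum⟩ := ENNReal.exists_pos_sum_of_countable'
    (ENNReal.div_pos hε.ne' (by simp : (2 : ℝ≥0∞) ≠ ∞)).ne' ℕ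
  choose l a ha hl using fun n => exists_subset_finsetCylinder hs hMs (htd n) (hδ n)
  refine ⟨fun n => (l n, a n), hAt.trans (iUnion_mono ha), ?_⟩
  calc ∑' n, (2⁻¹ : ℝ≥0∞) ^ l n
      ≤ ∑' n, (2 * (⨆ _ : (t n).Nonempty, Metric.ediam (t n) ^ s) + δ n) :=
        ENNReal.tsum_le_tsum hl
    _ = 2 * ∑' n, (⨆ _ : (t n).Nonempty, Metric.ediam (t n) ^ s) + ∑' n, δ n := by
        rw [ENNReal.tsum_add, ENNReal.tsum_mul_left]
    _ ≤ 2 * (ε / 4) + ε / 2 := by gcongr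
    _ = ε := by
        rw [show (4 : ℝ≥0∞) = 2 * 2 by norm_num, ← mul_div_assoc,
          ENNReal.mul_div_mul_left _ _ (by simp) (by simp), ENNReal.add_halves]

/-- An enumeration of all quintuples consisting of a triple of naturals (a scale and two labels) and
the data of a cylinder. -/
@[irreducible] def code : ℕ ≃ (ℕ × ℕ × ℕ) × ℕ × Finset ℕ := (Denumerable.eqv _).symm

/-- The cylinder with index `i`; its diameter to the power `1 / ((code i).1.1 + 1)` is at most
`2 ^ (-(code i).2.1)`. -/
def codedCylinder (i : ℕ) : Set (ℕ → Bool) :=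
  finsetCylinder (((code i).1.1 + 1) * (code i).2.1) (code i).2.2

/-- The points which are covered infinitely often, at every scale, by the cylinders in `D`. -/
def codedSet (D : Set ℕ) : Set (ℕ → Bool) :=
  {x | ∀ m, ∃ᶠ i in atTop, i ∈ D ∧ (code i).1.1 = m ∧ x ∈ codedCylinder i}

lemma codedSet_subset {D D' : Set ℕ} (h : ∀ᶠ i in atTop, i ∈ D → i ∈ D') :
    codedSet D ⊆ codedSet D' := fun _ hx m =>
  ((hx m).and_eventually h).mono fun _ hi => ⟨hi.2 hi.1.1, hi.1.2⟩

lemma dimH_codedSet {D : Set ℕ}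
    (hD : ∑' i, D.indicator (fun i => (2⁻¹ : ℝ≥0∞) ^ (code i).2.1) i ≠ ∞) :
    dimH (codedSet D) = 0 := by
  have key : ∀ m : ℕ, dimH (codedSet D) ≤ ((m : ℝ≥0∞) + 1)⁻¹ := by
    intro m
    have hs : (0 : ℝ) < ((m : ℝ) + 1)⁻¹ := by positivity
    let t : ℕ → Set (ℕ → Bool) := fun i => {x | i ∈ D ∧ (code i).1.1 = m ∧ x ∈ codedCylinder i}
    have ht : ∑' i, Metric.ediam (t i) ^ ((m : ℝ) + 1)⁻¹ ≠ ∞ := by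
      refine ne_top_of_le_ne_top hD (ENNReal.tsum_le_tsum fun i => ?_)
      by_cases hi : i ∈ D ∧ (code i).1.1 = m
      · rw [indicator_of_mem hi.1]
        have h1 : Metric.ediam (t i) ≤ (2⁻¹ : ℝ≥0∞) ^ ((m + 1) * (code i).2.1) := by
          refine (Metric.ediam_mono fun x hx => ?_).trans (ediam_cylinder_le
            (fun k => decide (k ∈ (code i).2.2)) _)
          have := hx.2.2
          rwa [codedCylinder, hi.2] at this
        refine (ENNReal.rpow_le_rpow h1 hs.le).trans_eq ?_
        rw [← ENNReal.rpow_natCast, ← ENNReal.rpow_mul, ← ENNReal.rpow_natCast]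
        congr 1
        push_cast
        field_simp
      · have : t i = ∅ := eq_empty_of_forall_notMem fun x hx => hi ⟨hx.1, hx.2.1⟩
        simp [this, ENNReal.zero_rpow_of_pos hs]
    have h0 := hausdorffMeasure_frequently_eq_zero hs ht
    have hsub : μH[((m : ℝ) + 1)⁻¹] (codedSet D) = 0 := measure_mono_null (fun x hx => hx m) h0
    have := dimH_le_of_hausdorffMeasure_ne_top (d := ((m : NNReal) + 1)⁻¹) (s := codedSet D)
      (by push_cast; rw [hsub]; simp)
    refine this.trans_eq ?_
    rw [ENNReal.coe_inv (by positivity)]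
    simp
  have h := (tendsto_add_atTop_iff_nat 1).2 ENNReal.tendsto_inv_nat_nhds_zero
  push_cast at h
  exact le_antisymm (ge_of_tendsto' h key) zero_le

lemma exists_subset_codedSet {A : Set (ℕ → Bool)} (hA : dimH A = 0) :
    ∃ D : Set ℕ, ∑' i, D.indicator (fun i => (2⁻¹ : ℝ≥0∞) ^ (code i).2.1) i ≠ ∞ ∧
      A ⊆ codedSet D := by
  obtain ⟨ε, hε, hεsum⟩ := ENNReal.exists_pos_sum_of_countable' one_ne_zero (ℕ × ℕ)
  have hf : ∀ p : ℕ × ℕ, ∃ f : ℕ → ℕ × Finset ℕ,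
      (A ⊆ ⋃ n, finsetCylinder ((p.1 + 1) * (f n).1) (f n).2) ∧
        ∑' n, (2⁻¹ : ℝ≥0∞) ^ (f n).1 ≤ ε p := fun p => by
    have hs : 0 < ((p.1 : NNReal) + 1)⁻¹ := by positivity
    refine exists_finsetCylinder_cover (s := (((p.1 : NNReal) + 1)⁻¹ : NNReal)) (by positivity)
      ?_ (hausdorffMeasure_of_dimH_lt ?_) (hε p)
    · push_cast
      field_simp
    · rw [hA]
      exact_mod_cast hs
  choose f hfA hfsum using hf
  let g : ℕ × ℕ × ℕ → ℕ := fun p => code.symm (p, f (p.1, p.2.1) p.2.2)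
  have hg : ∀ p, code (g p) = (p, f (p.1, p.2.1) p.2.2) := fun p => code.apply_symm_apply _
  have hginj : Function.Injective g := fun p q h => by
    have := congrArg (fun i => (code i).1) h
    simpa [hg] using this
  refine ⟨range g, ?_, fun x hx m => ?_⟩
  · rw [← tsum_subtype, tsum_range (fun i => (2⁻¹ : ℝ≥0∞) ^ (code i).2.1) hginj]
    simp only [hg]
    rw [← (Equiv.prodAssoc ℕ ℕ ℕ).tsum_eq, ENNReal.tsum_prod']
    refine ne_top_of_le_ne_top ENNReal.one_ne_top (le_trans ?_ hεsum.le)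
    exact ENNReal.tsum_le_tsum fun p => hfsum p
  · rw [Nat.frequently_atTop_iff_infinite]
    choose n hn using fun j => mem_iUnion.1 (hfA (m, j) hx)
    refine infinite_of_injective_forall_mem (f := fun j => g (m, j, n j)) (fun j k h => ?_) ?_
    · have := hginj h
      simp only [Prod.mk.injEq] at this
      exact this.2.1
    · intro j
      refine ⟨mem_range_self _, by rw [hg], ?_⟩
      rw [codedCylinder, hg]
      exact hn j

/-- All coordinates in the first `w i` places of the `i`-th block are `true`. -/
def blockEvent (w : ℕ → ℕ) (i : ℕ) : Set (ℕ → Bool) :=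
  {x | ∀ k < w i, x (Nat.pair i k) = true}

/-- The points which lie in infinitely many of the block events indexed by `D`. -/
def blockLimsup (w : ℕ → ℕ) (D : Set ℕ) : Set (ℕ → Bool) :=
  {x | ∃ᶠ i in atTop, i ∈ D ∧ x ∈ blockEvent w i}

lemma isOpen_blockEvent (w : ℕ → ℕ) (i : ℕ) : IsOpen (blockEvent w i) := by
  have : blockEvent w i = ⋂ k ∈ Finset.range (w i),
      (fun x : ℕ → Bool => x (Nat.pair i k)) ⁻¹' {true} := by
    ext x
    simp [blockEvent]
  rw [this]
  exact isOpen_biInter_finset fun k _ =>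
    (isOpen_discrete _).preimage (continuous_apply (Nat.pair i k))

lemma measure_forall_mem_eq_true (T : Finset ℕ) :
    μH[(1 : ℝ)] {x : ℕ → Bool | ∀ n ∈ T, x n = true} = 2⁻¹ ^ T.card := by
  obtain ⟨-, hind, hhalf⟩ := hausdorffMeasure_one_fair_coin
  have e : {x : ℕ → Bool | ∀ n ∈ T, x n = true} =
      ⋂ n ∈ T, (fun x : ℕ → Bool => x n) ⁻¹' {true} := by
    ext x
    simp
  rw [e, hind.measure_inter_preimage_eq_mul _ fun n _ => measurableSet_singleton _]
  refine (Finset.prod_congr rfl fun k _ => hhalf _ true).trans ?_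
  simp

lemma measure_biInter_blockEvent (w : ℕ → ℕ) (S : Finset ℕ) :
    μH[(1 : ℝ)] (⋂ i ∈ S, blockEvent w i) = ∏ i ∈ S, 2⁻¹ ^ w i := by
  have hinj : ∀ i, Function.Injective (Nat.pair i) := fun i a b h => (Nat.pair_eq_pair.1 h).2
  let T : ℕ → Finset ℕ := fun i => (Finset.range (w i)).image (Nat.pair i)
  have hT : ∀ i, (T i).card = w i := fun i => by
    rw [Finset.card_image_of_injective _ (hinj i), Finset.card_range]
  have hdisj : (S : Set ℕ).PairwiseDisjoint T := fun i _ j _ hij =>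
    Finset.disjoint_left.2 fun n hi hj => by
      obtain ⟨a, -, rfl⟩ := Finset.mem_image.1 hi
      obtain ⟨b, -, h⟩ := Finset.mem_image.1 hj
      exact hij (Nat.pair_eq_pair.1 h).1.symm
  have e : ⋂ i ∈ S, blockEvent w i = {x : ℕ → Bool | ∀ n ∈ S.biUnion T, x n = true} := by
    ext x
    simp only [blockEvent, mem_iInter, mem_ofPred_eq, Finset.mem_biUnion, T, Finset.mem_image,
      Finset.mem_range]
    constructor
    · rintro h _ ⟨i, hi, k, hk, rfl⟩
      exact h i hi k hk
    · exact fun h i hi k hk => h _ ⟨i, hi, k, hk, rfl⟩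
  rw [e, measure_forall_mem_eq_true, Finset.card_biUnion hdisj, Finset.prod_pow_eq_pow_sum]
  simp only [hT]

lemma measure_blockEvent (w : ℕ → ℕ) (i : ℕ) : μH[(1 : ℝ)] (blockEvent w i) = 2⁻¹ ^ w i := by
  simpa using measure_biInter_blockEvent w {i}

lemma measurableSet_mem_blockEvent (w : ℕ → ℕ) (D : Set ℕ) (i : ℕ) :
    MeasurableSet {x | i ∈ D ∧ x ∈ blockEvent w i} :=
  (MeasurableSet.const (i ∈ D)).inter (isOpen_blockEvent w i).measurableSet

lemma measure_mem_blockEvent (w : ℕ → ℕ) (D : Set ℕ) (i : ℕ) :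
    μH[(1 : ℝ)] {x | i ∈ D ∧ x ∈ blockEvent w i} =
      D.indicator (fun i => (2⁻¹ : ℝ≥0∞) ^ w i) i := by
  by_cases hi : i ∈ D
  · simp [hi, measure_blockEvent]
  · simp [hi]

lemma iIndepSet_blockEvent (w : ℕ → ℕ) (D : Set ℕ) :
    iIndepSet (fun i => {x | i ∈ D ∧ x ∈ blockEvent w i}) (μH[(1 : ℝ)]) := by
  have := hausdorffMeasure_one_fair_coin.1
  rw [iIndepSet_iff_meas_biInter (measurableSet_mem_blockEvent w D)]
  intro S
  simp only [measure_mem_blockEvent]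
  by_cases hS : ∀ i ∈ S, i ∈ D
  · rw [Finset.prod_congr rfl fun i hi => indicator_of_mem (hS i hi) _,
      ← measure_biInter_blockEvent]
    congr 1
    exact iInter₂_congr fun i hi => by simp [hS i hi]
  · push Not at hS
    obtain ⟨i, hi, hiD⟩ := hS
    rw [Finset.prod_eq_zero hi (indicator_of_notMem hiD _)]
    exact measure_mono_null (biInter_subset_of_mem hi) (by simp [hiD])

lemma tsum_ne_top_of_blockLimsup {w : ℕ → ℕ} {D : Set ℕ}
    (h : μH[(1 : ℝ)] (blockLimsup w D) ≠ 1) :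
    ∑' i, D.indicator (fun i => (2⁻¹ : ℝ≥0∞) ^ w i) i ≠ ∞ := by
  contrapose! h
  have := measure_limsup_eq_one (measurableSet_mem_blockEvent w D) (iIndepSet_blockEvent w D)
    (by simpa only [measure_mem_blockEvent] using h)
  rw [← this, limsup_eq_iInf_iSup_of_nat]
  congr 1
  ext x
  simp only [blockLimsup, frequently_atTop, mem_ofPred_eq, iInf_eq_iInter, iSup_eq_iUnion,
    mem_iInter, mem_iUnion, exists_prop, ge_iff_le]

lemma measure_blockLimsup_eq_zero {w : ℕ → ℕ} {D : Set ℕ}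
    (h : ∑' i, D.indicator (fun i => (2⁻¹ : ℝ≥0∞) ^ w i) i ≠ ∞) :
    μH[(1 : ℝ)] (blockLimsup w D) = 0 :=
  measure_setOfPred_frequently_eq_zero (p := fun i x => i ∈ D ∧ x ∈ blockEvent w i)
    (by simpa only [measure_mem_blockEvent] using h)

/-- A measurable set of positive measure contains a nonempty closed set all of whose nonempty
relatively open subsets have positive measure. -/
lemma exists_isClosed_forall_isOpen_pos {X : Type*} [TopologicalSpace X] [MeasurableSpace X]
    [OpensMeasurableSpace X] [HereditarilyLindelofSpace X] (μ : Measure X) [IsFiniteMeasure μ]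
    [μ.WeaklyRegular] {s : Set X} (hs : MeasurableSet s) (hpos : 0 < μ s) :
    ∃ K ⊆ s, IsClosed K ∧ K.Nonempty ∧
      ∀ V, IsOpen V → (K ∩ V).Nonempty → 0 < μ (K ∩ V) := by
  obtain ⟨K₀, hK₀s, hK₀, hK₀pos⟩ := hs.exists_lt_isClosed_of_ne_top (measure_ne_top μ s) hpos
  have hsupp := Measure.measure_compl_support (μ := μ.restrict K₀)
  refine ⟨K₀ ∩ (μ.restrict K₀).support, inter_subset_left.trans hK₀s,
    hK₀.inter Measure.isClosed_support, ?_, ?_⟩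
  · rw [nonempty_iff_ne_empty]
    intro h
    have hsub : K₀ ⊆ (μ.restrict K₀).supportᶜ := fun x hx hx' =>
      (h ▸ (⟨hx, hx'⟩ : x ∈ K₀ ∩ _) : x ∈ (∅ : Set X))
    have := measure_mono_null hsub hsupp
    rw [Measure.restrict_apply_self] at this
    exact hK₀pos.ne' this
  · rintro V hV ⟨x, ⟨-, hx⟩, hxV⟩
    have h1 := (Measure.mem_support_iff_forall x).1 hx V (hV.mem_nhds hxV)
    rw [← measure_inter_add_sdiff V
      (Measure.isClosed_support (μ := μ.restrict K₀)).measurableSet,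
      measure_mono_null (sdiff_subset_compl _ _) hsupp, add_zero,
      Measure.restrict_apply
        (hV.measurableSet.inter Measure.isClosed_support.measurableSet)] at h1
    refine h1.trans_le (measure_mono ?_)
    rintro y ⟨⟨hyV, hys⟩, hyK⟩
    exact ⟨⟨hyK, hys⟩, hyV⟩

lemma exists_inter_eq_empty_of_blockLimsup {w : ℕ → ℕ} {D : Set ℕ} {K : Set (ℕ → Bool)}
    (hK : IsClosed K) (hne : K.Nonempty) (hdisj : Disjoint K (blockLimsup w D)) :
    ∃ V, IsOpen V ∧ (K ∩ V).Nonempty ∧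
      ∀ᶠ i in atTop, i ∈ D → K ∩ V ∩ blockEvent w i = ∅ := by
  have : CompactSpace K := isCompact_iff_compactSpace.1 hK.isCompact
  have : Nonempty K := hne.to_subtype
  let G : ℕ → Set (ℕ → Bool) := fun n => ⋃ i ∈ {i | n ≤ i ∧ i ∈ D}, blockEvent w i
  have hG : ∀ n, IsOpen (G n) := fun n => isOpen_biUnion fun i _ => isOpen_blockEvent w i
  by_cases hd : ∀ n, Dense ((↑) ⁻¹' G n : Set K)
  · obtain ⟨x, hx⟩ := (dense_iInter_of_isOpen_nat
      (fun n => (hG n).preimage continuous_subtype_val) hd).nonempty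
    refine (disjoint_left.1 hdisj x.2 (frequently_atTop.2 fun n => ?_)).elim
    have := mem_iInter.1 hx n
    simp only [G, mem_preimage, mem_iUnion, mem_ofPred_eq] at this
    obtain ⟨i, ⟨hni, hiD⟩, hxi⟩ := this
    exact ⟨i, hni, hiD, hxi⟩
  · push Not at hd
    obtain ⟨n, hn⟩ := hd
    rw [dense_iff_inter_open] at hn
    push Not at hn
    obtain ⟨U, hU, ⟨x, hx⟩, hUG⟩ := hn
    obtain ⟨V, hV, rfl⟩ := isOpen_induced_iff.1 hU
    refine ⟨V, hV, ⟨x, x.2, hx⟩, eventually_atTop.2 ⟨n, fun i hi hiD => ?_⟩⟩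
    refine eq_empty_of_forall_notMem fun y hy => ?_
    have : (⟨y, hy.1.1⟩ : K) ∈ (∅ : Set K) := hUG ▸
      ⟨hy.1.2, mem_biUnion (show i ∈ {i | n ≤ i ∧ i ∈ D} from ⟨hi, hiD⟩) hy.2⟩
    exact this

lemma exists_countable_summable_of_null (w : ℕ → ℕ) {B : Set (ℕ → Bool)}
    (hB : μH[(1 : ℝ)] B = 0) :
    ∃ 𝒟 : Set (Set ℕ), 𝒟.Countable ∧
      (∀ D ∈ 𝒟, ∑' i, D.indicator (fun i => (2⁻¹ : ℝ≥0∞) ^ w i) i ≠ ∞) ∧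
      ∀ D, blockLimsup w D ⊆ B → ∃ D' ∈ 𝒟, ∀ᶠ i in atTop, i ∈ D → i ∈ D' := by
  obtain ⟨_, -, -⟩ := hausdorffMeasure_one_fair_coin
  let μ : Measure (ℕ → Bool) := μH[(1 : ℝ)]
  have hB' : μ (toMeasurable μ B)ᶜ = 1 := by
    rw [prob_compl_eq_one_iff (measurableSet_toMeasurable μ B), measure_toMeasurable]
    exact hB
  obtain ⟨K, hKB, hK, hne, hpos⟩ := exists_isClosed_forall_isOpen_pos μ
    (measurableSet_toMeasurable μ B).compl (hB' ▸ one_pos)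
  have hbasis := TopologicalSpace.isBasis_countableBasis (ℕ → Bool)
  let 𝒱 : Set (Set (ℕ → Bool)) :=
    {V ∈ TopologicalSpace.countableBasis (ℕ → Bool) | (K ∩ V).Nonempty}
  refine ⟨(fun V => {i | K ∩ V ∩ blockEvent w i = ∅}) '' 𝒱,
    ((TopologicalSpace.countable_countableBasis _).mono (sep_subset _ _)).image _, ?_, ?_⟩
  · rintro _ ⟨V, ⟨hV, hKV⟩, rfl⟩
    have hVo := hbasis.isOpen hV
    refine tsum_ne_top_of_blockLimsup fun h => (hpos V hVo hKV).ne' ?_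
    rw [← prob_compl_eq_one_iff (hK.measurableSet.inter hVo.measurableSet)]
    refine le_antisymm prob_le_one (h.symm.trans_le (measure_mono fun x hx hxKV => ?_))
    obtain ⟨i, hi, hxi⟩ := hx.exists
    exact (hi ▸ ⟨hxKV, hxi⟩ : x ∈ (∅ : Set (ℕ → Bool)))
  · intro D hD
    obtain ⟨V, hV, ⟨x, hxK, hxV⟩, hev⟩ := exists_inter_eq_empty_of_blockLimsup hK hne
      (disjoint_left.2 fun x hx hxD => hKB hx (subset_toMeasurable μ B (hD hxD)))
    obtain ⟨U, hU, hxU, hUV⟩ := hbasis.exists_subset_of_mem_open hxV hV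
    refine ⟨_, mem_image_of_mem _ ⟨hU, x, hxK, hxU⟩, hev.mono fun i hi hiD => ?_⟩
    exact subset_empty_iff.1 ((inter_subset_inter_left _ (inter_subset_inter_right _ hUV)).trans
      (hi hiD).subset)

lemma idealCof_le_of_tukey {X Y : Type} {I : Set (Set X)} {J : Set (Set Y)}
    (φ : Set X → Set Y) (ψ : Set Y → Set X) (hφ : ∀ A ∈ I, φ A ∈ J) (hψ : ∀ B ∈ J, ψ B ∈ I)
    (h : ∀ A ∈ I, ∀ B ∈ J, φ A ⊆ B → A ⊆ ψ B) : idealCof I ≤ idealCof J := by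
  obtain ⟨F, hFJ, hF, hc⟩ := csInf_mem (s := {c : Cardinal | ∃ F : Set (Set Y), F ⊆ J ∧
    (∀ A ∈ J, ∃ B ∈ F, A ⊆ B) ∧ c = Cardinal.mk F}) ⟨_, J, Subset.rfl,
      fun A hA => ⟨A, hA, Subset.rfl⟩, rfl⟩
  refine le_trans (csInf_le' ⟨ψ '' F, ?_, fun A hA => ?_, rfl⟩)
    (Cardinal.mk_image_le.trans hc.ge)
  · rintro _ ⟨B, hB, rfl⟩
    exact hψ B (hFJ hB)
  · obtain ⟨B, hB, hAB⟩ := hF _ (hφ A hA)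
    exact ⟨ψ B, mem_image_of_mem _ hB, h A hA B (hFJ hB) hAB⟩

/-- `cof(HDZ) ≤ cof(N¹)`, where
`N¹ = {A ⊆ 2^ω : ℋ¹(A) = 0}` and `HDZ = {A ⊆ 2^ω : dim_H(A) = 0}`. -/
theorem stmt19 :
    idealCof {A : Set (ℕ → Bool) | dimH A = 0} ≤
      idealCof {A : Set (ℕ → Bool) | μH[(1 : ℝ)] A = 0} := by
  choose! D hDsum hD using fun (A : Set (ℕ → Bool)) (hA : dimH A = 0) => exists_subset_codedSet hA
  choose! 𝒟 h𝒟c h𝒟sum h𝒟 using fun (B : Set (ℕ → Bool)) (hB : μH[(1 : ℝ)] B = 0) =>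
    exists_countable_summable_of_null (fun i => (code i).2.1) hB
  refine idealCof_le_of_tukey (fun A => blockLimsup (fun i => (code i).2.1) (D A))
    (fun B => ⋃ D' ∈ 𝒟 B, codedSet D') (fun A hA => measure_blockLimsup_eq_zero (hDsum A hA))
    (fun B hB => ?_) fun A hA B hB hAB => ?_
  · rw [mem_ofPred_eq, dimH_bUnion (h𝒟c B hB)]
    simp only [ENNReal.iSup_eq_zero]
    exact fun D' hD' => dimH_codedSet (h𝒟sum B hB D' hD')
  · obtain ⟨D', hD', hev⟩ := h𝒟 B hB (D A) hAB
    exact (hD A hA).trans ((codedSet_subset hev).trans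
      (subset_biUnion_of_mem (u := codedSet) hD'))
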